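/- arXiv:1405.0113 — 4 statements merged into one kernel-verified Lean document; each statement's English description precedes it below -/
import Mathlib

section
/- Let n ≥ 1 and d be integers with |d| ≥ 2, and let Δ be the Laplacian of the generalized de Bruijn graph DB(n,d) if d ≥ 2, or of the generalized Kautz graph Ktz(n,|d|) if d ≤ −2. Then the quotient of ℤ^n by the subgroup generated by the rows of Δ is isomorphic, as an abelian group, to ℤ ⊕ S(n,d), i.e. to ℤ ⊕ (𝒵_n/F_{n,d}). -/
open Finset

noncomputable section

/-- The ring `ℤ[x]/(x^n - 1)`, realized as the group algebra `ℤ[ℤ/n]`;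
the class of `x^j` (for `j : ℤ`) corresponds to `xp n (j : ZMod n)`. -/
abbrev Rn (n : ℕ) : Type := AddMonoidAlgebra ℤ (ZMod n)

/-- The class of `x^w` in `ℤ[x]/(x^n - 1)`. -/
def xp (n : ℕ) (w : ZMod n) : Rn n := AddMonoidAlgebra.single w 1

/-- `e_v = x^v - 1`. -/
def eV (n : ℕ) (w : ZMod n) : Rn n := xp n w - 1

/-- `ε_v = d·e_v - e_{d·v}`. -/
def epsV (n : ℕ) (d : ℤ) (w : ZMod n) : Rn n := d • eV n w - eV n ((d : ZMod n) * w)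

/-- `𝒵_n`, the ℤ-span of the `e_v`, `1 ≤ v ≤ n-1`. -/
def ZSpan (n : ℕ) : Submodule ℤ (Rn n) :=
  Submodule.span ℤ {a : Rn n | ∃ v : ℤ, 1 ≤ v ∧ v ≤ (n : ℤ) - 1 ∧ a = eV n (v : ZMod n)}

/-- `ℰ_{n,d}`, the ℤ-span of the `ε_v`, `1 ≤ v ≤ n-1`. -/
def ESpan (n : ℕ) (d : ℤ) : Submodule ℤ (Rn n) :=
  Submodule.span ℤ {a : Rn n | ∃ v : ℤ, 1 ≤ v ∧ v ≤ (n : ℤ) - 1 ∧ a = epsV n d (v : ZMod n)}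

/-- `1 + x + ⋯ + x^{|d|-1}`. -/
def geomT (n : ℕ) (d : ℤ) : Rn n := ∑ i ∈ Finset.range d.natAbs, xp n (i : ZMod n)

/-- `f_v`: the Laplacian row polynomial of `DB(n,d)` (for `d ≥ 0`) resp. of
`Ktz(n,|d|)` (for `d < 0`). -/
def fV (n : ℕ) (d : ℤ) (v : ℤ) : Rn n :=
  if 0 ≤ d then d • xp n ((v : ZMod n)) - xp n (((d * v : ℤ) : ZMod n)) * geomT n d
  else d • xp n ((v : ZMod n)) + xp n (((d * (v + 1) : ℤ) : ZMod n)) * geomT n d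

/-- `F_{n,d}`, the ℤ-span of the `f_v`, `1 ≤ v ≤ n-1`. -/
def FSpan (n : ℕ) (d : ℤ) : Submodule ℤ (Rn n) :=
  Submodule.span ℤ {a : Rn n | ∃ v : ℤ, 1 ≤ v ∧ v ≤ (n : ℤ) - 1 ∧ a = fV n d v}

/-- The sand dune group `Σ(n,d) = 𝒵_n / ℰ_{n,d}`. -/
abbrev SandDune (n : ℕ) (d : ℤ) :=
  ZSpan n ⧸ Submodule.comap (ZSpan n).subtype (ESpan n d)

/-- The sandpile (critical) group `S(n,d) = 𝒵_n / F_{n,d}`. -/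
abbrev Sandpile (n : ℕ) (d : ℤ) :=
  ZSpan n ⧸ Submodule.comap (ZSpan n).subtype (FSpan n d)

/-- The Laplacian of `DB(n,d)` (for `d ≥ 0`) resp. of `Ktz(n,|d|)` (for `d < 0`):
`Δ_{v,w} = |d|·[v = w] − #{0 ≤ i ≤ |d|−1 : w = (d·v resp. d·(v+1)) + i in ℤ/n}`. -/
def lap (n : ℕ) (d : ℤ) (v w : ZMod n) : ℤ :=
  (d.natAbs : ℤ) * (if v = w then 1 else 0) -
    (((Finset.range d.natAbs).filter
      (fun i : ℕ => w = (if 0 ≤ d then (d : ZMod n) * v else (d : ZMod n) * (v + 1)) + (i : ZMod n))).card : ℤ)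

section LaplacianQuotient

variable {n : ℕ}

theorem ZMod.sum_univ_eq_sum_range [NeZero n] {A : Type*} [AddCommMonoid A] (g : ZMod n → A) :
    ∑ w, g w = ∑ k ∈ range n, g (k : ZMod n) := by
  refine Finset.sum_nbij' (fun w => w.val) (fun k => (k : ZMod n)) ?_ ?_ ?_ ?_ ?_
  · exact fun w _ => mem_range.2 w.val_lt
  · exact fun _ _ => mem_univ _
  · exact fun w _ => ZMod.natCast_zmod_val w
  · exact fun k hk => ZMod.val_cast_of_lt (mem_range.1 hk)
  · exact fun w _ => by rw [ZMod.natCast_zmod_val]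

theorem Finset.sum_range_mul_eq {A : Type*} [AddCommMonoid A] (h : ℕ → A) (a b : ℕ) :
    ∑ k ∈ range (a * b), h k = ∑ q ∈ range a, ∑ r ∈ range b, h (q * b + r) := by
  induction a with
  | zero => simp
  | succ a ih => rw [Nat.succ_mul, sum_range_add, ih, sum_range_succ]

/-- The map `(v, i) ↦ m * v + i` from `ZMod n × {0, …, m - 1}` to `ZMod n` is `m`-to-one. -/
theorem ZMod.sum_sum_mul_add [NeZero n] {A : Type*} [AddCommMonoid A] (g : ZMod n → A) (m : ℕ) :
    ∑ v : ZMod n, ∑ i ∈ range m, g (m * v + i) = m • ∑ w, g w := by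
  have h₁ := Finset.sum_range_mul_eq (fun k => g (k : ZMod n)) n m
  have h₂ := Finset.sum_range_mul_eq (fun k => g (k : ZMod n)) m n
  rw [mul_comm m n, h₁] at h₂
  simp only [Nat.cast_add, Nat.cast_mul, CharP.cast_eq_zero, mul_zero, zero_add, sum_const,
    card_range] at h₂
  rw [ZMod.sum_univ_eq_sum_range, ZMod.sum_univ_eq_sum_range g, ← h₂]
  simp only [mul_comm]

/-- The first head of the arcs leaving `v`. -/
def arcBase (n : ℕ) (d : ℤ) (v : ZMod n) : ZMod n :=
  if 0 ≤ d then (d : ZMod n) * v else (d : ZMod n) * (v + 1)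

theorem sum_sum_arcBase_add [NeZero n] {A : Type*} [AddCommMonoid A] (d : ℤ) (g : ZMod n → A) :
    ∑ v : ZMod n, ∑ i ∈ range d.natAbs, g (arcBase n d v + i) = d.natAbs • ∑ w, g w := by
  rw [← ZMod.sum_sum_mul_add]
  by_cases h : 0 ≤ d
  · have hd : ((d.natAbs : ℕ) : ZMod n) = d := by
      rw [← Int.cast_natCast, Int.natAbs_of_nonneg h]
    simp only [arcBase, if_pos h, hd]
  · have hd : ((d.natAbs : ℕ) : ZMod n) = -d := by
      rw [← Int.cast_natCast, Int.ofNat_natAbs_of_nonpos (not_le.1 h).le, Int.cast_neg]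
    simp only [arcBase, if_neg h, hd]
    refine Fintype.sum_equiv ((Equiv.addRight (1 : ZMod n)).trans (Equiv.neg _)) _ _ fun v => ?_
    simp only [Equiv.trans_apply, Equiv.coe_addRight, Equiv.neg_apply, neg_mul_neg]

theorem sum_lap_smul [NeZero n] {A : Type*} [AddCommGroup A] (d : ℤ) (v : ZMod n)
    (g : ZMod n → A) :
    ∑ w, lap n d v w • g w = d.natAbs • g v - ∑ i ∈ range d.natAbs, g (arcBase n d v + i) := by
  have h : ∑ w, (((range d.natAbs).filter
      (fun i : ℕ => w = arcBase n d v + (i : ZMod n))).card : ℤ) • g w =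
      ∑ i ∈ range d.natAbs, g (arcBase n d v + i) := by
    simp only [card_filter, Nat.cast_sum, sum_smul]
    rw [sum_comm]
    refine sum_congr rfl fun i _ => ?_
    simp [ite_smul]
  have h' : ∑ w, ((d.natAbs : ℤ) * (if v = w then 1 else 0)) • g w = d.natAbs • g v := by
    simp only [mul_ite, mul_one, mul_zero, ite_smul, zero_smul, sum_ite_eq, mem_univ, if_true,
      natCast_zsmul]
  rw [← h, ← h', ← sum_sub_distrib]
  exact sum_congr rfl fun w _ => sub_smul _ _ _

/-- The integer vector `f` as the element `∑ f w • x^w` of the group algebra. -/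
def rowPoly (n : ℕ) [NeZero n] : (ZMod n → ℤ) →ₗ[ℤ] Rn n := Fintype.linearCombination ℤ (xp n)

theorem rowPoly_injective [NeZero n] : Function.Injective (rowPoly n) := by
  have key : ∀ (f : ZMod n → ℤ) (u : ZMod n), (rowPoly n f).coeff u = f u := by
    intro f u
    simp [rowPoly, Fintype.linearCombination_apply, xp, Finsupp.single_apply]
  intro f g h
  ext u
  rw [← key f, h, key]

theorem rowPoly_lap [NeZero n] (d v : ℤ) :
    rowPoly n (lap n d v) = if 0 ≤ d then fV n d v else -fV n d v := by
  rw [rowPoly, Fintype.linearCombination_apply, sum_lap_smul, ← natCast_zsmul]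
  have hx : ∀ a b : ZMod n, xp n (a + b) = xp n a * xp n b := fun a b => by
    simp [xp, AddMonoidAlgebra.single_mul_single]
  simp only [hx, ← mul_sum]
  by_cases h : 0 ≤ d
  · simp [fV, geomT, arcBase, h, abs_of_nonneg h]
  · simp only [fV, geomT, arcBase, if_neg h, Int.ofNat_natAbs_of_nonpos (not_le.1 h).le]
    push_cast
    rw [neg_smul]
    abel

theorem sum_lap_left [NeZero n] (d : ℤ) : ∑ v : ZMod n, lap n d v = 0 := by
  apply rowPoly_injective
  simp only [map_sum, map_zero, rowPoly, Fintype.linearCombination_apply, sum_lap_smul,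
    sum_sub_distrib, sum_sum_arcBase_add, ← smul_sum, sub_self]

theorem sum_lap_right [NeZero n] (d : ℤ) (v : ZMod n) : ∑ w, lap n d v w = 0 := by
  simpa using sum_lap_smul d v (fun _ => (1 : ℤ))

theorem map_rowPoly_span_lap [NeZero n] (d : ℤ) :
    (Submodule.span ℤ (Set.range fun v : ZMod n => lap n d v)).map (rowPoly n) = FSpan n d := by
  have hne : ∀ v : ZMod n, v ≠ 0 → rowPoly n (lap n d v) ∈ FSpan n d := by
    intro v hv
    have hpos : v.val ≠ 0 := fun h => hv ((ZMod.val_eq_zero v).1 h)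
    have hlt := v.val_lt
    have hmem : fV n d (v.val : ℤ) ∈ FSpan n d :=
      Submodule.subset_span ⟨v.val, by lia, by lia, rfl⟩
    have h := rowPoly_lap (n := n) d (v.val : ℤ)
    rw [Int.cast_natCast, ZMod.natCast_zmod_val] at h
    rw [h]
    split_ifs
    exacts [hmem, neg_mem hmem]
  rw [Submodule.map_span]
  apply le_antisymm
  · rw [Submodule.span_le]
    rintro _ ⟨_, ⟨v, rfl⟩, rfl⟩
    by_cases hv : v = 0
    · subst hv
      have h := sum_lap_left (n := n) d
      rw [← add_sum_erase _ _ (mem_univ (0 : ZMod n)), add_eq_zero_iff_eq_neg] at h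
      simp only [SetLike.mem_coe, h, map_neg, map_sum]
      exact neg_mem (sum_mem fun w hw => hne w (ne_of_mem_erase hw))
    · exact hne v hv
  · rw [FSpan, Submodule.span_le]
    rintro _ ⟨v, -, -, rfl⟩
    have hmem : rowPoly n (lap n d v) ∈ Submodule.span ℤ
        (rowPoly n '' Set.range fun v : ZMod n => lap n d v) :=
      Submodule.subset_span ⟨_, ⟨v, rfl⟩, rfl⟩
    rw [rowPoly_lap] at hmem
    split_ifs at hmem
    exacts [hmem, neg_mem_iff.1 hmem]

theorem eV_zero : eV n 0 = 0 := by
  simp [eV, xp, AddMonoidAlgebra.one_def]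

theorem eV_mem_ZSpan [NeZero n] (w : ZMod n) : eV n w ∈ ZSpan n := by
  by_cases hw : w = 0
  · rw [hw, eV_zero]
    exact zero_mem _
  · have hpos : w.val ≠ 0 := fun h => hw ((ZMod.val_eq_zero w).1 h)
    have hlt := w.val_lt
    exact Submodule.subset_span ⟨w.val, by lia, by lia, by simp⟩

/-- The projection `x^w ↦ e_w` onto `𝒵_n`. -/
def toZSpan (n : ℕ) [NeZero n] : (ZMod n → ℤ) →ₗ[ℤ] ZSpan n :=
  Fintype.linearCombination ℤ fun w => ⟨eV n w, eV_mem_ZSpan w⟩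

theorem coe_toZSpan [NeZero n] (f : ZMod n → ℤ) :
    (toZSpan n f : Rn n) = rowPoly n f - (∑ w, f w) • 1 := by
  simp [toZSpan, rowPoly, Fintype.linearCombination_apply, eV, smul_sub, sum_sub_distrib,
    sum_smul]

theorem toZSpan_single [NeZero n] (w : ZMod n) (k : ℤ) :
    toZSpan n (Pi.single w k) = k • ⟨eV n w, eV_mem_ZSpan w⟩ := by
  rw [toZSpan, Fintype.linearCombination_apply_single]

theorem toZSpan_surjective [NeZero n] : Function.Surjective (toZSpan n) := by
  have h : ZSpan n ≤ LinearMap.range ((ZSpan n).subtype ∘ₗ toZSpan n) := by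
    refine Submodule.span_le.2 ?_
    rintro _ ⟨v, -, -, rfl⟩
    refine ⟨Pi.single (v : ZMod n) 1, ?_⟩
    simp [toZSpan_single]
  intro z
  obtain ⟨f, hf⟩ := h z.2
  exact ⟨f, Subtype.ext hf⟩

/-- The degree of an integer vector together with the class of its projection to `𝒵_n`. -/
def degreeAndClass (n : ℕ) [NeZero n] (d : ℤ) : (ZMod n → ℤ) →ₗ[ℤ] ℤ × Sandpile n d :=
  (Fintype.linearCombination ℤ fun _ => (1 : ℤ)).prod
    (Submodule.mkQ (Submodule.comap (ZSpan n).subtype (FSpan n d)) ∘ₗ toZSpan n)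

theorem degreeAndClass_apply [NeZero n] (d : ℤ) (f : ZMod n → ℤ) :
    degreeAndClass n d f = (∑ w, f w, Submodule.Quotient.mk (toZSpan n f)) := by
  simp [degreeAndClass, Fintype.linearCombination_apply]

theorem degreeAndClass_surjective [NeZero n] (d : ℤ) :
    Function.Surjective (degreeAndClass n d) := by
  rintro ⟨k, z⟩
  obtain ⟨z, rfl⟩ := Submodule.Quotient.mk_surjective _ z
  obtain ⟨f, rfl⟩ := toZSpan_surjective z
  refine ⟨f + Pi.single 0 (k - ∑ w, f w), ?_⟩
  have h0 : (⟨eV n 0, eV_mem_ZSpan 0⟩ : ZSpan n) = 0 := Subtype.ext eV_zero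
  rw [degreeAndClass_apply, map_add, toZSpan_single, h0, smul_zero, add_zero]
  simp [sum_add_distrib]

theorem ker_degreeAndClass [NeZero n] (d : ℤ) :
    LinearMap.ker (degreeAndClass n d) =
      Submodule.span ℤ (Set.range fun v : ZMod n => lap n d v) := by
  have hdeg : Submodule.span ℤ (Set.range fun v : ZMod n => lap n d v) ≤
      LinearMap.ker (Fintype.linearCombination ℤ fun _ : ZMod n => (1 : ℤ)) := by
    rw [Submodule.span_le]
    rintro _ ⟨v, rfl⟩
    simpa [Fintype.linearCombination_apply] using sum_lap_right d v
  ext f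
  rw [LinearMap.mem_ker, degreeAndClass_apply, Prod.mk_eq_zero, Submodule.Quotient.mk_eq_zero,
    Submodule.mem_comap, Submodule.subtype_apply, coe_toZSpan, ← map_rowPoly_span_lap]
  constructor
  · rintro ⟨h0, h⟩
    rw [h0, zero_smul, sub_zero] at h
    obtain ⟨g, hg, hgf⟩ := h
    exact rowPoly_injective hgf ▸ hg
  · intro hf
    have h0 : ∑ w, f w = 0 := by
      simpa [Fintype.linearCombination_apply] using hdeg hf
    rw [h0, zero_smul, sub_zero]
    exact ⟨rfl, Submodule.mem_map_of_mem hf⟩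

end LaplacianQuotient

/-- the quotient of `ℤ^n` by the row space of the Laplacian of `DB(n,d)`
(if `d ≥ 2`) or `Ktz(n,|d|)` (if `d ≤ −2`) is isomorphic to `ℤ ⊕ S(n,d)`. -/
theorem stmt0 (n : ℕ) (d : ℤ) (hn : 1 ≤ n) (hd : 2 ≤ |d|) :
    Nonempty (((ZMod n → ℤ) ⧸ Submodule.span ℤ (Set.range fun v : ZMod n => lap n d v)) ≃+
      ℤ × Sandpile n d) := by
  have : NeZero n := ⟨by lia⟩
  exact ⟨((Submodule.quotEquivOfEq _ _ (ker_degreeAndClass d).symm).trans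
    ((degreeAndClass n d).quotKerEquivOfSurjective (degreeAndClass_surjective d))).toAddEquiv⟩
end
end

section
/- Let n ≥ 1 and d be integers with |d| ≥ 2. In ℚ[x]/(x^n − 1), the n−1 elements g_v = d·x^v·(x − 1) − x^{d·v}·(x^d − 1), for 1 ≤ v ≤ n−1, are linearly independent over ℚ; likewise the n−1 elements ε_v = d·(x^v − 1) − (x^{d·v} − 1), for 1 ≤ v ≤ n−1, are linearly independent over ℚ, so that their ℚ-span has dimension n − 1. -/
open Finset

noncomputable section

/-- The ℚ-algebra `ℚ[x]/(x^n - 1)`, realized as the group algebra `ℚ[ℤ/n]`. -/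
abbrev Qn (n : ℕ) : Type := AddMonoidAlgebra ℚ (ZMod n)

/-- The class of `x^w` in `ℚ[x]/(x^n - 1)`. -/
def xq (n : ℕ) (w : ZMod n) : Qn n := AddMonoidAlgebra.single w 1

/-- `e_v = x^v - 1` in `ℚ[x]/(x^n - 1)`. -/
def eQ (n : ℕ) (w : ZMod n) : Qn n := xq n w - 1

/-- `ε_v = d·e_v - e_{d·v}` in `ℚ[x]/(x^n - 1)`. -/
def epsQ (n : ℕ) (d : ℤ) (w : ZMod n) : Qn n := (d : ℚ) • eQ n w - eQ n ((d : ZMod n) * w)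

/-- `g_v = d·x^v·(x − 1) − x^{d·v}·(x^d − 1)` in `ℚ[x]/(x^n - 1)`. -/
def gQ (n : ℕ) (d : ℤ) (w : ZMod n) : Qn n :=
  (d : ℚ) • (xq n w * (xq n 1 - 1)) - xq n ((d : ZMod n) * w) * (xq n (d : ZMod n) - 1)

/-- The linear map out of `ℚ[x]/(x^n - 1)` with prescribed values on the powers of `x`. -/
def xqLift (n : ℕ) {M : Type*} [AddCommGroup M] [Module ℚ M] (L : ZMod n → M) : Qn n →ₗ[ℚ] M :=
  Finsupp.linearCombination ℚ L ∘ₗ (AddMonoidAlgebra.coeffLinearEquiv ℚ).toLinearMap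

@[simp]
lemma xqLift_xq (n : ℕ) {M : Type*} [AddCommGroup M] [Module ℚ M] (L : ZMod n → M)
    (w : ZMod n) : xqLift n L (xq n w) = L w := by
  simp [xqLift, xq]

lemma xq_hom_ext {n : ℕ} {M : Type*} [AddCommGroup M] [Module ℚ M] {f g : Qn n →ₗ[ℚ] M}
    (h : ∀ w, f (xq n w) = g (xq n w)) : f = g := by
  refine AddMonoidAlgebra.lhom_ext' fun w => LinearMap.ext_ring ?_
  simpa [xq] using h w

lemma xq_zero (n : ℕ) : xq n 0 = 1 := rfl

lemma xq_mul_xq (n : ℕ) (v w : ZMod n) : xq n v * xq n w = xq n (v + w) := by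
  simp [xq, AddMonoidAlgebra.single_mul_single]

/-- The linear map `x^w ↦ x^(c·w)` on `ℚ[x]/(x^n - 1)`. -/
def expMul (n : ℕ) (c : ZMod n) : Qn n →ₗ[ℚ] Qn n := xqLift n fun w => xq n (c * w)

@[simp]
lemma expMul_xq (n : ℕ) (c w : ZMod n) : expMul n c (xq n w) = xq n (c * w) :=
  xqLift_xq n _ w

lemma expMul_expMul (n : ℕ) (b c : ZMod n) (f : Qn n) :
    expMul n b (expMul n c f) = expMul n (b * c) f := by
  have h : expMul n b ∘ₗ expMul n c = expMul n (b * c) := xq_hom_ext fun w => by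
    simp [mul_assoc]
  exact LinearMap.congr_fun h f

lemma expMul_one (n : ℕ) (f : Qn n) : expMul n 1 f = f := by
  have h : expMul n 1 = LinearMap.id := xq_hom_ext fun w => by simp
  exact LinearMap.congr_fun h f

lemma expMul_pow_apply_of_eigenvector {n : ℕ} {c : ZMod n} {a : ℚ} {f : Qn n}
    (hf : expMul n c f = a • f) (k : ℕ) : expMul n (c ^ k) f = a ^ k • f := by
  induction k with
  | zero => simp [expMul_one]
  | succ k ih => rw [pow_succ, ← expMul_expMul, hf, map_smul, ih, smul_smul, pow_succ']

/-- The linear map `x^w ↦ d·x^w - x^(d·w)` on `ℚ[x]/(x^n - 1)`. -/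
def distributionMap (n : ℕ) (d : ℤ) : Qn n →ₗ[ℚ] Qn n :=
  (d : ℚ) • LinearMap.id - expMul n (d : ZMod n)

lemma distributionMap_xq (n : ℕ) (d : ℤ) (w : ZMod n) :
    distributionMap n d (xq n w) = (d : ℚ) • xq n w - xq n ((d : ZMod n) * w) := by
  simp [distributionMap]

/-- Since `d` has finitely many powers modulo `n`, the operator `x^w ↦ x^(d·w)` has no
eigenvalue `d` when `|d| ≥ 2`. -/
lemma ker_distributionMap {n : ℕ} {d : ℤ} (hn : 1 ≤ n) (hd : 2 ≤ |d|) :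
    LinearMap.ker (distributionMap n d) = ⊥ := by
  have : NeZero n := ⟨by lia⟩
  rw [LinearMap.ker_eq_bot']
  intro f hf
  have hf' : expMul n (d : ZMod n) f = (d : ℚ) • f :=
    (sub_eq_zero.mp hf).symm
  obtain ⟨k, l, hkl, h⟩ :=
    Finite.exists_ne_map_eq_of_infinite fun k : ℕ => (d : ZMod n) ^ k
  have hpow : (d : ℚ) ^ k • f = (d : ℚ) ^ l • f := by
    rw [← expMul_pow_apply_of_eigenvector hf', ← expMul_pow_apply_of_eigenvector hf']
    exact congrArg (fun c => expMul n c f) h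
  rw [← sub_eq_zero, ← sub_smul, smul_eq_zero] at hpow
  refine hpow.resolve_left fun h0 => hkl ?_
  have h1 : d ^ k = d ^ l := by exact_mod_cast sub_eq_zero.mp h0
  exact Int.pow_right_injective (by rw [Int.abs_eq_natAbs] at hd; exact_mod_cast hd) h1

lemma epsQ_eq_distributionMap (n : ℕ) (d : ℤ) (w : ZMod n) :
    epsQ n d w = distributionMap n d (eQ n w) := by
  simp only [epsQ, eQ, ← xq_zero, map_sub, distributionMap_xq, mul_zero, smul_sub]
  abel

lemma gQ_eq_distributionMap (n : ℕ) (d : ℤ) (w : ZMod n) :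
    gQ n d w = distributionMap n d (xq n (w + 1) - xq n w) := by
  simp only [gQ, mul_sub, mul_one, xq_mul_xq, map_sub, distributionMap_xq, smul_sub, mul_add]
  abel

lemma linearIndependent_eQ (n : ℕ) :
    LinearIndependent ℚ (fun v : Fin (n - 1) => eQ n ((v.1 + 1 : ℕ) : ZMod n)) := by
  have hval (v : Fin (n - 1)) : ((v.1 + 1 : ℕ) : ZMod n).val = v.1 + 1 :=
    ZMod.val_cast_of_lt (by lia)
  refine LinearIndependent.of_pairwise_dual_eq_zero_one _
    (fun i => xqLift n fun w => if w.val = i.1 + 1 then (1 : ℚ) else 0) (fun i j hij => ?_)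
    fun i => ?_
  · simp only [eQ, ← xq_zero, map_sub, xqLift_xq, hval, ZMod.val_zero]
    grind
  · simp only [eQ, ← xq_zero, map_sub, xqLift_xq, hval, ZMod.val_zero]
    grind

lemma linearIndependent_xq_succ_sub (n : ℕ) :
    LinearIndependent ℚ (fun v : Fin (n - 1) =>
      xq n (((v.1 + 1 : ℕ) : ZMod n) + 1) - xq n ((v.1 + 1 : ℕ) : ZMod n)) := by
  have hval (v : Fin (n - 1)) : ((v.1 + 1 : ℕ) : ZMod n).val = v.1 + 1 :=
    ZMod.val_cast_of_lt (by lia)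
  have hval' (v : Fin (n - 1)) : (((v.1 + 1 : ℕ) : ZMod n) + 1).val =
      if v.1 + 2 = n then 0 else v.1 + 2 := by
    rw [← Nat.cast_add_one, ZMod.val_natCast]
    split_ifs with h
    · simp [← h]
    · exact Nat.mod_eq_of_lt (by lia)
  refine LinearIndependent.of_pairwise_dual_eq_zero_one _
    (fun i => xqLift n fun w => if 1 ≤ w.val ∧ w.val ≤ i.1 + 1 then (-1 : ℚ) else 0)
    (fun i j hij => ?_) fun i => ?_
  · simp only [map_sub, xqLift_xq, hval, hval']
    grind
  · simp only [map_sub, xqLift_xq, hval, hval']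
    grind

/-- in `ℚ[x]/(x^n−1)` the `n−1` elements `g_v` (`1 ≤ v ≤ n−1`) are
ℚ-linearly independent, and so are the `n−1` elements `ε_v` (`1 ≤ v ≤ n−1`), whose
ℚ-span therefore has dimension `n − 1`. -/
theorem stmt1 (n : ℕ) (d : ℤ) (hn : 1 ≤ n) (hd : 2 ≤ |d|) :
    LinearIndependent ℚ (fun v : Fin (n - 1) => gQ n d ((v.1 + 1 : ℕ) : ZMod n)) ∧
    LinearIndependent ℚ (fun v : Fin (n - 1) => epsQ n d ((v.1 + 1 : ℕ) : ZMod n)) ∧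
    Module.finrank ℚ
      (Submodule.span ℚ (Set.range fun v : Fin (n - 1) => epsQ n d ((v.1 + 1 : ℕ) : ZMod n)))
      = n - 1 := by
  have hker := ker_distributionMap (d := d) hn hd
  have heps : LinearIndependent ℚ
      (fun v : Fin (n - 1) => epsQ n d ((v.1 + 1 : ℕ) : ZMod n)) := by
    simp only [epsQ_eq_distributionMap]
    exact (linearIndependent_eQ n).map' _ hker
  refine ⟨?_, heps, by rw [finrank_span_eq_card heps, Fintype.card_fin]⟩
  simp only [gQ_eq_distributionMap]
  exact (linearIndependent_xq_succ_sub n).map' _ hker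
end
end

section
/- Let n ≥ 1 and d be integers with |d| ≥ 2, and set n_1 = n/gcd(n, |d|). Then the subgroup d·Σ(n,d) = {d·g : g ∈ Σ(n,d)} of Σ(n,d) is isomorphic to Σ(n_1, d), and the subgroup d·S(n,d) = {d·g : g ∈ S(n,d)} of S(n,d) is isomorphic to S(n_1, d). -/
open Finset

noncomputable section

lemma xp_add (n : ℕ) (v w : ZMod n) : xp n (v + w) = xp n v * xp n w := by
  simp [xp, AddMonoidAlgebra.single_mul_single]

lemma xp_zero (n : ℕ) : xp n 0 = 1 := rfl

lemma xp_natCast (n i : ℕ) : xp n (i : ZMod n) = xp n 1 ^ i := by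
  induction i with
  | zero => simp [xp_zero]
  | succ i ih => rw [Nat.cast_succ, xp_add, ih, pow_succ]

lemma xp_one_pow_self (n : ℕ) : xp n 1 ^ n = 1 := by
  rw [← xp_natCast, ZMod.natCast_self, xp_zero]

lemma span_range_xp (n : ℕ) : Submodule.span ℤ (Set.range (xp n)) = ⊤ := by
  refine eq_top_iff.2 fun p _ => ?_
  induction p using AddMonoidAlgebra.induction_linear with
  | zero => exact zero_mem _
  | add x y hx hy => exact add_mem (hx trivial) (hy trivial)
  | single w r =>
    have : AddMonoidAlgebra.single w r = r • xp n w := by simp [xp]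
    rw [this]
    exact Submodule.smul_mem _ _ (Submodule.subset_span ⟨w, rfl⟩)

lemma linearMap_ext_xp {n : ℕ} {M : Type*} [AddCommGroup M] {f g : Rn n →ₗ[ℤ] M}
    (h : ∀ w, f (xp n w) = g (xp n w)) (p : Rn n) : f p = g p := by
  have : f = g := LinearMap.ext_on_range (span_range_xp n) h
  rw [this]

lemma eq_of_zsmul_eq {n : ℕ} {d : ℤ} (hd : d ≠ 0) {p q : Rn n} (h : d • p = d • q) : p = q :=
  smul_right_injective _ hd h

/-- The augmentation `x ↦ 1`. -/
def augmentation (n : ℕ) : Rn n →ₐ[ℤ] ℤ := AddMonoidAlgebra.lift ℤ ℤ (ZMod n) 1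

@[simp] lemma augmentation_xp (n : ℕ) (w : ZMod n) : augmentation n (xp n w) = 1 := by
  simp [augmentation, xp]

/-- The homomorphism `ℤ/a → ℤ/b`, `v ↦ c·v`. -/
def mulHom {a b : ℕ} (c : ℤ) (h : (b : ℤ) ∣ a * c) : ZMod a →+ ZMod b :=
  ZMod.lift a ⟨zmultiplesHom (ZMod b) (c : ZMod b), by
    have := (ZMod.intCast_zmod_eq_zero_iff_dvd _ b).2 h
    push_cast at this
    simpa using this⟩

lemma mulHom_intCast {a b : ℕ} (c : ℤ) (h : (b : ℤ) ∣ a * c) (v : ℤ) :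
    mulHom c h (v : ZMod a) = ((v * c : ℤ) : ZMod b) := by
  simp [mulHom]

/-- The ring homomorphism `R_a → R_b`, `x ↦ x^c`. -/
def powHom {a b : ℕ} (c : ℤ) (h : (b : ℤ) ∣ a * c) : Rn a →ₐ[ℤ] Rn b :=
  AddMonoidAlgebra.mapDomainAlgHom ℤ ℤ (mulHom c h)

lemma powHom_xp {a b : ℕ} (c : ℤ) (h : (b : ℤ) ∣ a * c) (w : ZMod a) :
    powHom c h (xp a w) = xp b (mulHom c h w) := by
  simp [powHom, xp]

lemma powHom_xp_intCast {a b : ℕ} (c : ℤ) (h : (b : ℤ) ∣ a * c) (v : ℤ) :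
    powHom c h (xp a (v : ZMod a)) = xp b ((v * c : ℤ) : ZMod b) := by
  rw [powHom_xp, mulHom_intCast]

lemma powHom_xp_one {a b : ℕ} (c : ℤ) (h : (b : ℤ) ∣ a * c) :
    powHom c h (xp a 1) = xp b (c : ZMod b) := by
  simpa using powHom_xp_intCast c h 1

lemma augmentation_powHom {a b : ℕ} (c : ℤ) (h : (b : ℤ) ∣ a * c) (p : Rn a) :
    augmentation b (powHom c h p) = augmentation a p :=
  linearMap_ext_xp (f := (augmentation b).toLinearMap ∘ₗ (powHom c h).toLinearMap)
    (g := (augmentation a).toLinearMap) (fun w => by simp [powHom_xp]) p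

lemma powHom_powHom {a b m : ℕ} (c c' e : ℤ) (h : (b : ℤ) ∣ a * c) (h' : (m : ℤ) ∣ b * c')
    (h'' : (m : ℤ) ∣ a * e) (he : ((c * c' : ℤ) : ZMod m) = e) (p : Rn a) :
    powHom c' h' (powHom c h p) = powHom e h'' p := by
  refine linearMap_ext_xp (f := (powHom c' h').toLinearMap ∘ₗ (powHom c h).toLinearMap)
    (g := (powHom e h'').toLinearMap) (fun w => ?_) p
  obtain ⟨v, rfl⟩ := ZMod.intCast_surjective w
  simp only [LinearMap.comp_apply, AlgHom.toLinearMap_apply, powHom_xp_intCast]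
  congr 1
  push_cast at he ⊢
  rw [← he, mul_assoc]

lemma powHom_eq_self {a : ℕ} (c : ℤ) (h : (a : ℤ) ∣ a * c) (hc : (c : ZMod a) = 1) (p : Rn a) :
    powHom c h p = p := by
  refine linearMap_ext_xp (f := (powHom c h).toLinearMap) (g := LinearMap.id) (fun w => ?_) p
  obtain ⟨v, rfl⟩ := ZMod.intCast_surjective w
  simp [powHom_xp_intCast, hc]

lemma ZSpan_eq_ker (n : ℕ) [NeZero n] :
    ZSpan n = LinearMap.ker (augmentation n).toLinearMap := by
  apply le_antisymm
  · refine Submodule.span_le.2 ?_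
    rintro _ ⟨v, -, -, rfl⟩
    simp [eV]
  · intro p hp
    have key : ∀ q : Rn n, q - augmentation n q • 1 ∈ ZSpan n := fun q => by
      have : q ∈ Submodule.span ℤ (Set.range (xp n)) := by simp [span_range_xp]
      induction this using Submodule.span_induction with
      | mem x hx =>
        obtain ⟨w, rfl⟩ := hx
        rw [augmentation_xp, one_smul]
        by_cases hw : w = 0
        · simp [hw, xp_zero]
        · refine Submodule.subset_span ⟨(w.val : ℤ), ?_, ?_, ?_⟩
          · have := (ZMod.val_ne_zero w).2 hw
            omega
          · have := ZMod.val_lt w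
            omega
          · simp [eV]
      | zero => simp
      | add x y _ _ hx hy =>
        rw [map_add, add_smul, add_sub_add_comm]
        exact add_mem hx hy
      | smul r x _ hx =>
        rw [map_zsmul, smul_assoc, ← smul_sub]
        exact Submodule.smul_mem _ _ hx
    have h0 : augmentation n p = 0 := hp
    simpa [h0] using key p

lemma mem_ZSpan {n : ℕ} [NeZero n] {p : Rn n} : p ∈ ZSpan n ↔ augmentation n p = 0 := by
  rw [ZSpan_eq_ker]; rfl

/-- Since `ι ∘ π` acts as multiplication by `d` on `A₀ / (d - ι ∘ π) A₁`, the multiples of `d`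
there form the quotient `B₀ / (d - π ∘ ι) B₁`. -/
lemma nonempty_range_zsmul_addEquiv {A B : Type*} [AddCommGroup A] [AddCommGroup B] (d : ℤ)
    (π : A →ₗ[ℤ] B) (ι : B →ₗ[ℤ] A) (A₀ A₁ FA : Submodule ℤ A) (B₀ B₁ FB : Submodule ℤ B)
    (hι : Function.Injective ι) (hA : A₀ ≤ A₁) (hπ : A₀.map π = B₀)
    (hι₀ : ∀ b ∈ B₀, ι b ∈ A₀) (hι₁ : ∀ b ∈ B₁, ι b ∈ A₁)
    (hFA : FA = A₁.map (d • LinearMap.id - ι ∘ₗ π))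
    (hFB : FB = B₁.map (d • LinearMap.id - π ∘ₗ ι))
    (H : ∀ a ∈ A₁, ∀ b, d • a = ι b → ∃ c ∈ B₁, ∃ u, d • u = ι (π u) ∧ a = ι c + u) :
    Nonempty ((zsmulAddGroupHom d :
        (A₀ ⧸ FA.comap A₀.subtype) →+ (A₀ ⧸ FA.comap A₀.subtype)).range ≃+
      (B₀ ⧸ FB.comap B₀.subtype)) := by
  let θ : B₀ →ₗ[ℤ] A₀ ⧸ FA.comap A₀.subtype :=
    (FA.comap A₀.subtype).mkQ ∘ₗ ι.restrict hι₀
  have hker : LinearMap.ker θ = FB.comap B₀.subtype := by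
    ext ⟨b, hb⟩
    have h1 : (⟨b, hb⟩ : B₀) ∈ LinearMap.ker θ ↔ ι b ∈ FA := by
      simp [θ, LinearMap.mem_ker, Submodule.Quotient.mk_eq_zero]
    rw [h1]
    simp only [Submodule.mem_comap, Submodule.subtype_apply]
    rw [hFA, hFB]
    constructor
    · rintro ⟨a, ha, hab⟩
      have hab' : d • a - ι (π a) = ι b := hab
      obtain ⟨c, hc, u, hu, rfl⟩ := H a ha (b + π a) (by rw [map_add, ← hab']; abel)
      refine ⟨c, hc, hι ?_⟩
      change ι (d • c - π (ι c)) = ι b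
      rw [← hab', map_sub, map_zsmul, smul_add, hu]
      simp only [map_add]
      abel
    · rintro ⟨c, hc, hcb⟩
      have hcb' : d • c - π (ι c) = b := hcb
      refine ⟨ι c, hι₁ c hc, ?_⟩
      change d • ι c - ι (π (ι c)) = ι b
      rw [← hcb', map_sub, map_zsmul]
  have hmk (a : A₀) (b : B₀) (h : π a = b) :
      θ b = d • (FA.comap A₀.subtype).mkQ a := by
    rw [← map_zsmul, eq_comm, ← sub_eq_zero]
    change (FA.comap A₀.subtype).mkQ _ - (FA.comap A₀.subtype).mkQ _ = 0
    rw [← map_sub, Submodule.mkQ_apply, Submodule.Quotient.mk_eq_zero, Submodule.mem_comap, hFA]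
    exact ⟨a, hA a.2, by simp [h]⟩
  have hrange : (LinearMap.range θ).toAddSubgroup = (zsmulAddGroupHom d :
        (A₀ ⧸ FA.comap A₀.subtype) →+ (A₀ ⧸ FA.comap A₀.subtype)).range := by
    ext y
    constructor
    · rintro ⟨b, rfl⟩
      obtain ⟨a, ha, hab⟩ : (b : B) ∈ A₀.map π := hπ ▸ b.2
      exact ⟨(FA.comap A₀.subtype).mkQ ⟨a, ha⟩, (hmk ⟨a, ha⟩ b hab).symm⟩
    · rintro ⟨z, rfl⟩
      obtain ⟨a, rfl⟩ := Submodule.mkQ_surjective _ z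
      exact ⟨⟨π a, hπ ▸ ⟨a, a.2, rfl⟩⟩, hmk a _ rfl⟩
  rw [← hrange, ← hker]
  exact ⟨(LinearMap.quotKerEquivRange θ).symm.toAddEquiv⟩

section Geometric

variable {R : Type*} [CommRing R]

lemma geom_sum_mul_eq (x : R) (a b : ℕ) :
    ∑ i ∈ range (a * b), x ^ i = (∑ i ∈ range a, x ^ i) * ∑ i ∈ range b, (x ^ a) ^ i := by
  induction b with
  | zero => simp
  | succ b ih =>
    rw [Nat.mul_succ, sum_range_add, ih, sum_range_succ _ b, mul_add, sum_mul _ _ ((x ^ a) ^ b)]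
    congr 1
    exact sum_congr rfl fun i _ => by rw [← pow_mul, ← pow_add, add_comm]

end Geometric

/-- `1 + x + ⋯ + x^{n-1}`. -/
def normElt (n : ℕ) : Rn n := ∑ i ∈ range n, xp n 1 ^ i

lemma geomT_eq (n : ℕ) (d : ℤ) : geomT n d = ∑ i ∈ range d.natAbs, xp n 1 ^ i :=
  sum_congr rfl fun i _ => xp_natCast n i

lemma augmentation_geomT (n : ℕ) (d : ℤ) : augmentation n (geomT n d) = d.natAbs := by
  simp [geomT]

lemma augmentation_normElt (n : ℕ) : augmentation n (normElt n) = n := by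
  simp [normElt]

/-- An element fixed by `x` absorbs everything up to augmentation. -/
lemma mul_eq_augmentation_smul {n : ℕ} [NeZero n] {q : Rn n} (hq : xp n 1 * q = q) (p : Rn n) :
    p * q = augmentation n p • q := by
  have hpow (i : ℕ) : xp n 1 ^ i * q = q := by
    induction i with
    | zero => simp
    | succ i ih => rw [pow_succ, mul_assoc, hq, ih]
  refine linearMap_ext_xp (f := LinearMap.mulRight ℤ q)
    (g := LinearMap.toSpanSingleton ℤ _ q ∘ₗ (augmentation n).toLinearMap) (fun w => ?_) p
  rw [LinearMap.mulRight_apply, ← ZMod.natCast_zmod_val w, xp_natCast, hpow]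
  simp

lemma xp_one_mul_normElt (n : ℕ) : xp n 1 * normElt n = normElt n := by
  have := mul_geom_sum (xp n 1) n
  rw [xp_one_pow_self, sub_self, sub_mul, one_mul, sub_eq_zero] at this
  exact this

lemma mul_normElt {n : ℕ} [NeZero n] (p : Rn n) :
    p * normElt n = augmentation n p • normElt n :=
  mul_eq_augmentation_smul (xp_one_mul_normElt n) p

/-- The multiplier `C` such that `x^v ↦ C·x^{d·v}` is the transition map of `DB(n,d)`,
resp. of `Ktz(n,|d|)` up to sign. -/
def transCoeff (n : ℕ) (d : ℤ) : Rn n :=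
  if 0 ≤ d then geomT n d else -(xp n (d : ZMod n) * geomT n d)

lemma augmentation_transCoeff (n : ℕ) (d : ℤ) : augmentation n (transCoeff n d) = d := by
  unfold transCoeff
  split_ifs with h
  · rw [augmentation_geomT]; omega
  · rw [map_neg, map_mul, augmentation_geomT, augmentation_xp]; omega

/-- The map `x^v ↦ C·x^{d·v}`, with `f_v = d·x^v - C·x^{d·v}`. -/
def transMap (n : ℕ) (d : ℤ) : Rn n →ₗ[ℤ] Rn n :=
  LinearMap.mulLeft ℤ (transCoeff n d) ∘ₗ (powHom d (dvd_mul_right _ _)).toLinearMap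

lemma transMap_apply (n : ℕ) (d : ℤ) (p : Rn n) :
    transMap n d p = transCoeff n d * powHom d (dvd_mul_right _ _) p := rfl

lemma fV_eq (n : ℕ) (d v : ℤ) :
    fV n d v = (d • (LinearMap.id : Rn n →ₗ[ℤ] Rn n) - transMap n d) (xp n (v : ZMod n)) := by
  simp only [LinearMap.sub_apply, LinearMap.smul_apply, LinearMap.id_apply, transMap_apply,
    powHom_xp_intCast, fV, transCoeff, mul_comm v d]
  split_ifs with h
  · simp [mul_comm]
  · have : ((d * (v + 1) : ℤ) : ZMod n) = (d : ZMod n) + ((d * v : ℤ) : ZMod n) := by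
      push_cast; ring
    rw [this, xp_add]
    simp [mul_right_comm]

lemma exists_transCoeff_mul_eq {n : ℕ} [NeZero n] {s : ℤ} (hs0 : s ≠ 0)
    (hs : IsCoprime (n : ℤ) s) : ∃ (q : Rn n) (t : ℤ), transCoeff n s * q = 1 + t • normElt n := by
  obtain ⟨q, t, h⟩ : ∃ (q : Rn n) (t : ℤ), geomT n s * q = 1 + t • normElt n := by
    obtain ⟨l, t, hlt⟩ : ∃ l t : ℕ, s.natAbs * l = n * t + 1 := by
      have hco : s.natAbs.Coprime n := by
        simpa using (Int.isCoprime_iff_nat_coprime.1 hs).symm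
      obtain rfl | hn : n = 1 ∨ 1 < n := by have := NeZero.pos n; omega
      · exact ⟨1, s.natAbs - 1, by omega⟩
      · obtain ⟨l, -, hl⟩ := Nat.exists_mul_mod_eq_one_of_coprime hco hn
        exact ⟨l, s.natAbs * l / n, by rw [← hl, Nat.div_add_mod]⟩
    refine ⟨∑ i ∈ range l, (xp n 1 ^ s.natAbs) ^ i, t, ?_⟩
    rw [geomT_eq, ← geom_sum_mul_eq, hlt, geom_sum_succ, geom_sum_mul_eq, xp_one_pow_self,
      ← normElt, ← mul_assoc, xp_one_mul_normElt]
    simp [mul_comm, add_comm]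
  unfold transCoeff
  split_ifs
  · exact ⟨q, t, h⟩
  · refine ⟨-(xp n (-s : ZMod n) * q), t, ?_⟩
    have hx : xp n (s : ZMod n) * xp n (-s : ZMod n) = 1 := by
      rw [← xp_add, add_neg_cancel, xp_zero]
    linear_combination h + geomT n s * q * hx

lemma powHom_normElt {n : ℕ} [NeZero n] {s : ℤ} (hs : IsCoprime (n : ℤ) s) :
    powHom s (dvd_mul_right _ _) (normElt n) = normElt n := by
  obtain ⟨u, r, hr⟩ := hs
  have hfix : xp n 1 * powHom s (dvd_mul_right _ _) (normElt n) =
      powHom s (dvd_mul_right _ _) (normElt n) := by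
    have hx : powHom (a := n) (b := n) s (dvd_mul_right _ _) (xp n (r : ZMod n)) = xp n 1 := by
      rw [powHom_xp_intCast, eq_sub_of_add_eq' hr]
      simp
    rw [← hx, ← map_mul, mul_normElt, augmentation_xp, one_smul]
  have h1 := mul_eq_augmentation_smul hfix (normElt n)
  have h2 := mul_normElt (powHom (a := n) (b := n) s (dvd_mul_right _ _) (normElt n))
  rw [mul_comm, h1, augmentation_powHom, augmentation_normElt] at h2
  exact eq_of_zsmul_eq (by simp [NeZero.ne n]) h2

section Factorization

variable (m g : ℕ) (s : ℤ)

/-- The reduction `R_{mg} → R_m`, `x ↦ x`. -/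
def reduction : Rn (m * g) →ₐ[ℤ] Rn m := powHom 1 (by simp)

/-- The inclusion `R_m → R_{mg}`, `x ↦ x^g`. -/
def inclusion : Rn m →ₐ[ℤ] Rn (m * g) := powHom g (by simp)

/-- A retraction of `inclusion`, killing the powers of `x` that are not powers of `x^g`. -/
def retraction : Rn (m * g) →ₗ[ℤ] Rn m :=
  Finsupp.linearCombination ℤ (fun w : ZMod (m * g) =>
    if g ∣ w.val then xp m ((w.val / g : ℕ) : ZMod m) else 0) ∘ₗ
  (AddMonoidAlgebra.coeffLinearEquiv ℤ).toLinearMap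

lemma retraction_xp (w : ZMod (m * g)) : retraction m g (xp (m * g) w) =
    if g ∣ w.val then xp m ((w.val / g : ℕ) : ZMod m) else 0 := by
  simp [retraction, xp]

lemma reduction_surjective : Function.Surjective (reduction m g) := by
  have : LinearMap.range (reduction m g).toLinearMap = ⊤ := by
    rw [eq_top_iff, ← span_range_xp, Submodule.span_le]
    rintro _ ⟨w, rfl⟩
    obtain ⟨v, rfl⟩ := ZMod.intCast_surjective w
    exact ⟨xp _ (v : ZMod (m * g)), by simp [reduction, powHom_xp_intCast]⟩
  exact LinearMap.range_eq_top.1 this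

lemma inclusion_powHom_reduction (p : Rn (m * g)) :
    inclusion m g (powHom s (dvd_mul_right _ _) (reduction m g p)) =
      powHom (s * g) (dvd_mul_right _ _) p := by
  rw [inclusion, reduction, powHom_powHom 1 s s _ _ (by simp [mul_assoc])
    (by simp), powHom_powHom]
  simp

lemma reduction_inclusion_powHom (p : Rn m) :
    reduction m g (inclusion m g (powHom s (dvd_mul_right _ _) p)) =
      powHom (s * g) (dvd_mul_right _ _) p := by
  rw [inclusion, reduction, powHom_powHom s g (s * g) _ _ (by simp [mul_dvd_mul])
    (by simp), powHom_powHom]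
  simp

lemma inclusion_geomT_mul :
    inclusion m g (geomT m s) * geomT (m * g) g = geomT (m * g) (s * g) := by
  have hx : inclusion m g (xp m 1) = xp (m * g) 1 ^ g := by
    rw [inclusion, powHom_xp_one, Int.cast_natCast, xp_natCast]
  rw [geomT_eq, geomT_eq, geomT_eq, Int.natAbs_mul, Int.natAbs_natCast, mul_comm s.natAbs,
    geom_sum_mul_eq, map_sum]
  simp [hx, mul_comm (∑ i ∈ range g, _)]

lemma inclusion_normElt_mul : inclusion m g (normElt m) * geomT (m * g) g = normElt (m * g) := by
  have h := inclusion_geomT_mul m g m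
  have h1 : geomT m m = normElt m := geomT_eq m m
  have h2 : geomT (m * g) (m * g : ℕ) = normElt (m * g) := geomT_eq (m * g) (m * g : ℕ)
  rw [h1, ← Nat.cast_mul, h2] at h
  exact h

lemma reduction_normElt : reduction m g (normElt (m * g)) = g • normElt m := by
  have hx : reduction m g (xp (m * g) 1) = xp m 1 := by
    rw [reduction, powHom_xp_one, Int.cast_one]
  rw [normElt, map_sum]
  simp only [map_pow, hx]
  rw [geom_sum_mul_eq, xp_one_pow_self, ← normElt]
  simp [mul_comm]

lemma reduction_transCoeff (d : ℤ) : reduction m g (transCoeff (m * g) d) = transCoeff m d := by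
  have hx (v : ℤ) : reduction m g (xp (m * g) (v : ZMod (m * g))) = xp m (v : ZMod m) := by
    rw [reduction, powHom_xp_intCast, mul_one]
  have hg : reduction m g (geomT (m * g) d) = geomT m d := by
    simpa [geomT] using sum_congr rfl fun i _ => hx (i : ℕ)
  unfold transCoeff
  split_ifs
  · exact hg
  · rw [map_neg, map_mul, hg, hx]

/-- The map `R_m → R_{mg}` through which `transMap (m * g) (s * g)` factors. -/
def descentMap : Rn m →ₗ[ℤ] Rn (m * g) :=
  LinearMap.mulLeft ℤ (transCoeff (m * g) (s * g)) ∘ₗ (inclusion m g).toLinearMap ∘ₗ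
    (powHom s (dvd_mul_right _ _)).toLinearMap

lemma descentMap_apply (p : Rn m) : descentMap m g s p =
    transCoeff (m * g) (s * g) * inclusion m g (powHom s (dvd_mul_right _ _) p) := rfl

lemma descentMap_comp_reduction :
    descentMap m g s ∘ₗ (reduction m g).toLinearMap = transMap (m * g) (s * g) := by
  refine LinearMap.ext fun p => ?_
  simp [descentMap_apply, transMap_apply, inclusion_powHom_reduction]

lemma reduction_comp_descentMap :
    (reduction m g).toLinearMap ∘ₗ descentMap m g s = transMap m (s * g) := by
  refine LinearMap.ext fun p => ?_
  simp [descentMap_apply, transMap_apply, reduction_inclusion_powHom, reduction_transCoeff]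

variable [NeZero g]

lemma inclusion_transCoeff_mul :
    inclusion m g (transCoeff m s) * geomT (m * g) g = transCoeff (m * g) (s * g) := by
  have hsg : 0 ≤ s * (g : ℤ) ↔ 0 ≤ s := mul_nonneg_iff_of_pos_right (by simp [NeZero.pos g])
  have h := inclusion_geomT_mul m g s
  unfold transCoeff
  simp only [hsg]
  split_ifs
  · exact h
  · rw [map_neg, map_mul, ← h, inclusion, powHom_xp_intCast]
    ring

lemma descentMap_eq (p : Rn m) : descentMap m g s p =
    inclusion m g (transCoeff m s * powHom s (dvd_mul_right _ _) p) * geomT (m * g) g := by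
  rw [descentMap_apply, ← inclusion_transCoeff_mul, map_mul]
  ring

variable [NeZero m]

lemma retraction_inclusion_mul_pow (p : Rn m) {i : ℕ} (hi : i < g) :
    retraction m g (inclusion m g p * xp (m * g) 1 ^ i) = if i = 0 then p else 0 := by
  have key (w : ZMod m) : retraction m g (inclusion m g (xp m w) * xp (m * g) 1 ^ i) =
      if i = 0 then xp m w else 0 := by
    have hw := ZMod.val_lt w
    have hlt : w.val * g + i < m * g := by nlinarith
    have : inclusion m g (xp m w) * xp (m * g) 1 ^ i =
        xp (m * g) ((w.val * g + i : ℕ) : ZMod (m * g)) := by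
      conv_lhs => rw [← ZMod.natCast_zmod_val w, ← Int.cast_natCast]
      rw [inclusion, powHom_xp_intCast, ← xp_natCast, ← xp_add]
      push_cast
      rfl
    have hg : 0 < g := NeZero.pos g
    rw [this, retraction_xp, ZMod.val_natCast_of_lt hlt]
    by_cases h0 : i = 0
    · simp [h0, hg]
    · have : ¬ g ∣ w.val * g + i := by
        rw [Nat.dvd_add_right (dvd_mul_left _ _)]
        exact fun h => h0 (Nat.eq_zero_of_dvd_of_lt h hi)
      rw [if_neg this, if_neg h0]
  split_ifs with h0
  · simp only [h0, if_true] at key ⊢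
    exact linearMap_ext_xp (f := retraction m g ∘ₗ
      LinearMap.mulRight ℤ (xp (m * g) 1 ^ 0) ∘ₗ (inclusion m g).toLinearMap)
      (g := LinearMap.id) key p
  · simp only [h0, if_false] at key
    exact linearMap_ext_xp (f := retraction m g ∘ₗ
      LinearMap.mulRight ℤ (xp (m * g) 1 ^ i) ∘ₗ (inclusion m g).toLinearMap)
      (g := 0) key p

lemma retraction_inclusion (p : Rn m) : retraction m g (inclusion m g p) = p := by
  simpa using retraction_inclusion_mul_pow m g p (NeZero.pos g)

lemma retraction_inclusion_mul_geomT (p : Rn m) :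
    retraction m g (inclusion m g p * geomT (m * g) g) = p := by
  rw [geomT_eq, Int.natAbs_natCast, mul_sum, map_sum,
    sum_congr rfl fun i hi => retraction_inclusion_mul_pow m g p (mem_range.1 hi)]
  simp [NeZero.ne g]

lemma map_reduction_ZSpan :
    (ZSpan (m * g)).map (reduction m g).toLinearMap = ZSpan m := by
  ext b
  constructor
  · rintro ⟨a, ha, rfl⟩
    rw [mem_ZSpan]
    exact (augmentation_powHom _ _ a).trans (mem_ZSpan.1 ha)
  · intro hb
    obtain ⟨a, rfl⟩ := reduction_surjective m g b
    exact ⟨a, mem_ZSpan.2 ((augmentation_powHom _ _ a).symm.trans (mem_ZSpan.1 hb)), rfl⟩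

end Factorization

section Coprime

variable {m g : ℕ} {s : ℤ}

lemma exists_powHom_eq (hs : IsCoprime (m : ℤ) s) :
    ∃ f : Rn m →ₗ[ℤ] Rn m, (∀ p, powHom s (dvd_mul_right _ _) (f p) = p) ∧
      (∀ p, f (powHom s (dvd_mul_right _ _) p) = p) := by
  obtain ⟨u, r, hr⟩ := hs
  have hc : ((s * r : ℤ) : ZMod m) = 1 := by
    rw [mul_comm, eq_sub_of_add_eq' hr]
    simp
  refine ⟨(powHom r (dvd_mul_right _ _)).toLinearMap, fun p => ?_, fun p => ?_⟩
  · rw [AlgHom.toLinearMap_apply,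
      powHom_powHom r s (s * r) _ _ (dvd_mul_right _ _) (by rw [mul_comm]), powHom_eq_self _ _ hc]
  · rw [AlgHom.toLinearMap_apply,
      powHom_powHom s r (s * r) _ _ (dvd_mul_right _ _) rfl, powHom_eq_self _ _ hc]

variable [NeZero m] [NeZero g]

lemma descentMap_normElt (hs : IsCoprime (m : ℤ) s) :
    descentMap m g s (normElt m) = s • normElt (m * g) := by
  rw [descentMap_eq, powHom_normElt hs, mul_normElt, augmentation_transCoeff, map_zsmul,
    smul_mul_assoc, inclusion_normElt_mul]

lemma transMap_normElt_of_isCoprime (hs : IsCoprime (m : ℤ) s) :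
    transMap (m * g) (s * g) (normElt (m * g)) = (s * g) • normElt (m * g) := by
  rw [← descentMap_comp_reduction, LinearMap.comp_apply, AlgHom.toLinearMap_apply,
    reduction_normElt, map_nsmul, descentMap_normElt hs, ← natCast_zsmul, smul_smul, mul_comm s]

lemma descentMap_injective (hs0 : s ≠ 0) (hs : IsCoprime (m : ℤ) s) :
    Function.Injective (descentMap m g s) := by
  rw [← LinearMap.ker_eq_bot, LinearMap.ker_eq_bot']
  intro p hp
  obtain ⟨f, -, hf⟩ := exists_powHom_eq hs
  obtain ⟨q, t, hq⟩ := exists_transCoeff_mul_eq hs0 hs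
  set r := powHom s (dvd_mul_right _ _) p with hr
  have h1 : transCoeff m s * r = 0 := by
    rw [← retraction_inclusion_mul_geomT m g (transCoeff m s * r), ← descentMap_eq, hp, map_zero]
  have h2 : augmentation m r = 0 := by
    have := congrArg (augmentation m) h1
    rw [map_mul, augmentation_transCoeff, map_zero] at this
    exact (mul_eq_zero.1 this).resolve_left hs0
  have h3 : r = 0 := by
    have h4 := mul_normElt r
    rw [h2, zero_smul] at h4
    have h5 : (1 + t • normElt m) * r = 0 := by rw [← hq, mul_right_comm, h1, zero_mul]
    rw [add_mul, one_mul, smul_mul_assoc, mul_comm, h4, smul_zero, add_zero] at h5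
    exact h5
  rw [← hf p, ← hr, h3, map_zero]

lemma exists_descentMap_add (hs0 : s ≠ 0) (hs : IsCoprime (m : ℤ) s) {a : Rn (m * g)} {b : Rn m}
    (h : (s * g) • a = descentMap m g s b) :
    ∃ (c : Rn m) (t : ℤ), a = descentMap m g s c + t • normElt (m * g) := by
  obtain ⟨f, hf, -⟩ := exists_powHom_eq hs
  obtain ⟨q, t, hq⟩ := exists_transCoeff_mul_eq hs0 hs
  have hd : s * g ≠ 0 := mul_ne_zero hs0 (by simp [NeZero.ne g])
  set a' := retraction m g a with ha'
  have ha : a = inclusion m g a' * geomT (m * g) g := by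
    refine eq_of_zsmul_eq hd ?_
    rw [← smul_mul_assoc, ← map_zsmul, ha', ← map_zsmul, h, descentMap_eq,
      retraction_inclusion_mul_geomT]
  refine ⟨f (q * a'), -(t * augmentation m a'), ?_⟩
  have h1 : transCoeff m s * (q * a') = a' + (t * augmentation m a') • normElt m := by
    rw [← mul_assoc, hq, add_mul, one_mul, smul_mul_assoc, mul_comm (normElt m), mul_normElt,
      smul_smul]
  rw [descentMap_eq, hf, h1, map_add, add_mul, map_zsmul, smul_mul_assoc, inclusion_normElt_mul,
    ← ha, neg_smul, add_neg_cancel_right]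

end Coprime

lemma exists_factorization {n : ℕ} {d : ℤ} (hn : n ≠ 0) (hd : d ≠ 0) :
    ∃ (m g : ℕ) (s : ℤ), n / n.gcd d.natAbs = m ∧ n = m * g ∧ d = s * g ∧ m ≠ 0 ∧ g ≠ 0 ∧
      s ≠ 0 ∧ IsCoprime (m : ℤ) s := by
  have hg : 0 < n.gcd d.natAbs := Nat.gcd_pos_of_pos_left _ (Nat.pos_of_ne_zero hn)
  have hn' : n = n / n.gcd d.natAbs * n.gcd d.natAbs :=
    (Nat.div_mul_cancel (Nat.gcd_dvd_left _ _)).symm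
  have hdvd : ((n.gcd d.natAbs : ℕ) : ℤ) ∣ d := Int.natCast_dvd.2 (Nat.gcd_dvd_right _ _)
  have hd' : d = d / (n.gcd d.natAbs : ℕ) * (n.gcd d.natAbs : ℕ) := (Int.ediv_mul_cancel hdvd).symm
  refine ⟨_, n.gcd d.natAbs, d / (n.gcd d.natAbs : ℕ), rfl, hn', hd', ?_, hg.ne', ?_, ?_⟩
  · intro h
    rw [h, zero_mul] at hn'
    exact hn hn'
  · intro h
    rw [h, zero_mul] at hd'
    exact hd hd'
  · rw [Int.isCoprime_iff_nat_coprime, Int.natAbs_natCast, Int.natAbs_ediv_of_dvd hdvd,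
      Int.natAbs_natCast]
    exact Nat.coprime_div_gcd_div_gcd hg

lemma transMap_normElt {n : ℕ} [NeZero n] {d : ℤ} (hd : d ≠ 0) :
    transMap n d (normElt n) = d • normElt n := by
  obtain ⟨m, g, s, -, rfl, rfl, hm, hg, -, hs⟩ := exists_factorization (NeZero.ne n) hd
  have : NeZero m := ⟨hm⟩
  have : NeZero g := ⟨hg⟩
  exact transMap_normElt_of_isCoprime hs

lemma ESpan_eq_map (n : ℕ) (d : ℤ) : ESpan n d = (ZSpan n).map
    (d • (LinearMap.id : Rn n →ₗ[ℤ] Rn n) -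
      (powHom (a := n) (b := n) d (dvd_mul_right _ _)).toLinearMap) := by
  have key (v : ℤ) : epsV n d (v : ZMod n) =
      (d • (LinearMap.id : Rn n →ₗ[ℤ] Rn n) -
      (powHom (a := n) (b := n) d (dvd_mul_right _ _)).toLinearMap)
        (eV n (v : ZMod n)) := by
    simp [epsV, eV, powHom_xp_intCast, mul_comm]
  rw [ZSpan, Submodule.map_span, ESpan]
  congr 1
  ext a
  constructor
  · rintro ⟨v, h1, h2, rfl⟩
    exact ⟨_, ⟨v, h1, h2, rfl⟩, (key v).symm⟩
  · rintro ⟨_, ⟨v, h1, h2, rfl⟩, rfl⟩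
    exact ⟨v, h1, h2, (key v).symm⟩

lemma FSpan_eq_map {n : ℕ} [NeZero n] {d : ℤ} (hd : d ≠ 0) : FSpan n d =
    (⊤ : Submodule ℤ (Rn n)).map (d • (LinearMap.id : Rn n →ₗ[ℤ] Rn n) - transMap n d) := by
  apply le_antisymm
  · refine Submodule.span_le.2 ?_
    rintro _ ⟨v, -, -, rfl⟩
    exact ⟨xp n v, trivial, (fV_eq n d v).symm⟩
  · have hpos (i : ℕ) (h1 : 1 ≤ i) (h2 : i < n) : fV n d i ∈ FSpan n d :=
      Submodule.subset_span ⟨i, by omega, by omega, rfl⟩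
    have hzero : fV n d (0 : ℕ) ∈ FSpan n d := by
      obtain ⟨k, hk⟩ := Nat.exists_eq_succ_of_ne_zero (NeZero.ne n)
      have hsum : ∑ i ∈ range n, fV n d (i : ℕ) = 0 := by
        simp only [fV_eq, Int.cast_natCast, xp_natCast]
        rw [← map_sum, ← normElt, LinearMap.sub_apply, transMap_normElt hd]
        simp
      rw [hk, sum_range_succ', ← hk] at hsum
      rw [eq_neg_of_add_eq_zero_right hsum]
      exact neg_mem (sum_mem fun i hi => hpos _ (by omega) (by have := mem_range.1 hi; omega))
    rw [← span_range_xp, Submodule.map_span, Submodule.span_le]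
    rintro _ ⟨_, ⟨w, rfl⟩, rfl⟩
    have hw : xp n w = xp n ((w.val : ℤ) : ZMod n) := by simp
    rw [hw, SetLike.mem_coe, ← fV_eq]
    rcases Nat.eq_zero_or_pos w.val with h | h
    · rw [h]; exact hzero
    · exact hpos _ h (ZMod.val_lt w)

lemma nonempty_range_zsmul_sandDune {m g : ℕ} {s : ℤ} [NeZero m] [NeZero g] (hs0 : s ≠ 0)
    (hs : IsCoprime (m : ℤ) s) :
    Nonempty ((zsmulAddGroupHom (s * g) :
      SandDune (m * g) (s * g) →+ SandDune (m * g) (s * g)).range ≃+ SandDune m (s * g)) := by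
  have hd : s * g ≠ 0 := mul_ne_zero hs0 (by simp [NeZero.ne g])
  obtain ⟨f, hf, hf'⟩ := exists_powHom_eq hs
  refine nonempty_range_zsmul_addEquiv (s * g) (reduction m g).toLinearMap
    ((inclusion m g).toLinearMap ∘ₗ (powHom s (dvd_mul_right _ _)).toLinearMap)
    (ZSpan (m * g)) (ZSpan (m * g)) _ (ZSpan m) (ZSpan m) _ ?_ le_rfl
    (map_reduction_ZSpan m g) ?_ ?_ ?_ ?_ ?_
  · exact (Function.LeftInverse.injective (retraction_inclusion m g)).comp
      (Function.LeftInverse.injective hf')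
  · intro b hb
    rw [mem_ZSpan, LinearMap.comp_apply, AlgHom.toLinearMap_apply, AlgHom.toLinearMap_apply,
      inclusion, augmentation_powHom, augmentation_powHom]
    exact mem_ZSpan.1 hb
  · intro b hb
    rw [mem_ZSpan, LinearMap.comp_apply, AlgHom.toLinearMap_apply, AlgHom.toLinearMap_apply,
      inclusion, augmentation_powHom, augmentation_powHom]
    exact mem_ZSpan.1 hb
  · rw [ESpan_eq_map]
    congr 2
    exact LinearMap.ext fun p => (inclusion_powHom_reduction m g s p).symm
  · rw [ESpan_eq_map]
    congr 2
    exact LinearMap.ext fun p => (reduction_inclusion_powHom m g s p).symm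
  · intro a ha b hab
    have ha' : inclusion m g (retraction m g a) = a := by
      refine eq_of_zsmul_eq hd ?_
      rw [← map_zsmul, ← map_zsmul, hab]
      simp [retraction_inclusion]
    refine ⟨f (retraction m g a), ?_, 0, by simp, by simp [hf, ha']⟩
    rw [mem_ZSpan, ← augmentation_powHom s (dvd_mul_right _ _), hf,
      ← augmentation_powHom g (by simp : ((m * g : ℕ) : ℤ) ∣ m * g), ← inclusion, ha']
    exact mem_ZSpan.1 ha

lemma nonempty_range_zsmul_sandpile {m g : ℕ} {s : ℤ} [NeZero m] [NeZero g] (hs0 : s ≠ 0)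
    (hs : IsCoprime (m : ℤ) s) :
    Nonempty ((zsmulAddGroupHom (s * g) :
      Sandpile (m * g) (s * g) →+ Sandpile (m * g) (s * g)).range ≃+ Sandpile m (s * g)) := by
  have hd : s * g ≠ 0 := mul_ne_zero hs0 (by simp [NeZero.ne g])
  refine nonempty_range_zsmul_addEquiv (s * g) (reduction m g).toLinearMap (descentMap m g s)
    (ZSpan (m * g)) ⊤ _ (ZSpan m) ⊤ _ (descentMap_injective hs0 hs) le_top
    (map_reduction_ZSpan m g) ?_ (fun _ _ => trivial) ?_ ?_ ?_
  · intro b hb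
    rw [mem_ZSpan, descentMap_apply, map_mul, inclusion, augmentation_powHom, augmentation_powHom,
      mem_ZSpan.1 hb, mul_zero]
  · rw [FSpan_eq_map hd, descentMap_comp_reduction]
  · rw [FSpan_eq_map hd, reduction_comp_descentMap]
  · intro a _ b hab
    obtain ⟨c, t, rfl⟩ := exists_descentMap_add hs0 hs hab
    refine ⟨c, trivial, t • normElt (m * g), ?_, rfl⟩
    have h := LinearMap.congr_fun (descentMap_comp_reduction m g s) (t • normElt (m * g))
    rw [LinearMap.comp_apply] at h
    rw [h, map_zsmul, transMap_normElt hd, smul_comm]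

/-- with `n₁ = n / gcd(n, |d|)`, the subgroup `d·Σ(n,d)` of `Σ(n,d)`
is isomorphic to `Σ(n₁,d)`, and the subgroup `d·S(n,d)` of `S(n,d)` is isomorphic
to `S(n₁,d)`. -/
theorem stmt7 (n : ℕ) (d : ℤ) (hn : 1 ≤ n) (hd : 2 ≤ |d|) :
    Nonempty ((zsmulAddGroupHom d : SandDune n d →+ SandDune n d).range ≃+
      SandDune (n / Nat.gcd n d.natAbs) d) ∧
    Nonempty ((zsmulAddGroupHom d : Sandpile n d →+ Sandpile n d).range ≃+
      Sandpile (n / Nat.gcd n d.natAbs) d) := by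
  have hd0 : d ≠ 0 := by
    rintro rfl
    simp at hd
  obtain ⟨m, g, s, h, h1, h2, hm, hg, hs0, hs⟩ := exists_factorization (by omega : n ≠ 0) hd0
  rw [h]
  subst h1 h2
  have : NeZero m := ⟨hm⟩
  have : NeZero g := ⟨hg⟩
  exact ⟨nonempty_range_zsmul_sandDune hs0 hs, nonempty_range_zsmul_sandpile hs0 hs⟩
end
end

section
/- Let G be a finite abelian group, let d and m be positive integers, and let d' be the largest divisor of d that is coprime to m. If ℤ/m is a direct summand of the subgroup d·G = {d·g : g ∈ G}, then ℤ/(m·d/d') is a direct summand of G. In particular, if d divides m, then ℤ/(m·d) is a direct summand of G. -/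
/-- If `φ : G →+ A` sends an element `y` killed by `n` to an element of order `n` that generates
the range of `φ`, then `y` generates a direct summand of `G` complementary to `ker φ`. -/
theorem nonempty_addEquiv_zmod_prod_ker {G A : Type*} [AddCommGroup G] [AddCommGroup A]
    {n : ℕ} (φ : G →+ A) {y : G} (hy : n • y = 0) (hn : addOrderOf (φ y) = n)
    (hφ : ∀ g, φ g ∈ AddSubgroup.zmultiples (φ y)) :
    Nonempty (G ≃+ ZMod n × φ.ker) := by
  let ι : ZMod n →+ G := ZMod.lift n ⟨zmultiplesHom G y, by simpa using hy⟩
  have hι (k : ℤ) : ι k = k • y := by simp [ι]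
  refine ⟨(AddEquiv.ofBijective (ι.coprod φ.ker.subtype) ⟨?_, fun g => ?_⟩).symm⟩
  · rw [injective_iff_map_eq_zero]
    rintro ⟨a, b, hb⟩ h
    obtain ⟨k, rfl⟩ := ZMod.intCast_surjective a
    simp only [AddMonoidHom.coprod_apply, hι, AddSubgroup.subtype_apply] at h
    have hk : k • φ y = 0 := by
      simpa [(AddMonoidHom.mem_ker).1 hb] using congrArg φ h
    rw [← addOrderOf_dvd_iff_zsmul_eq_zero, hn] at hk
    have hk0 : (k : ZMod n) = 0 := (ZMod.intCast_zmod_eq_zero_iff_dvd k n).2 hk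
    have hky : k • y = 0 := by rw [← hι, hk0, map_zero]
    have hb0 : b = 0 := by simpa [hky] using h
    ext <;> simp [hk0, hb0]
  · obtain ⟨k, hk⟩ := AddSubgroup.mem_zmultiples_iff.1 (hφ g)
    refine ⟨((k : ZMod n), ⟨g - k • y, ?_⟩), ?_⟩
    · simp [AddMonoidHom.mem_ker, hk]
    · simp [hι]

/-- An element of order `n` of `ℚ ⧸ ℤ` generates the `n`-torsion. -/
theorem AddCircle.mem_zmultiples_of_nsmul_eq_zero {n : ℕ} (hn : 0 < n)
    {w z : AddCircle (1 : ℚ)} (hw : addOrderOf w = n) (hz : n • z = 0) :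
    z ∈ AddSubgroup.zmultiples w := by
  let u : AddCircle (1 : ℚ) := ((1 / n : ℚ) : AddCircle (1 : ℚ))
  have hu : addOrderOf u = n := AddCircle.addOrderOf_period_div hn
  have key {z : AddCircle (1 : ℚ)} (hz : n • z = 0) : z ∈ AddSubgroup.zmultiples u := by
    obtain ⟨q, rfl⟩ := QuotientAddGroup.mk_surjective z
    obtain ⟨k, hk⟩ := (AddCircle.coe_eq_zero_iff (1 : ℚ) (x := n • q)).1 hz
    refine AddSubgroup.mem_zmultiples_iff.2 ⟨k, ?_⟩
    have hq : q = k • (1 / n : ℚ) := by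
      have : (n : ℚ) ≠ 0 := by positivity
      simp only [zsmul_eq_mul, nsmul_eq_mul] at hk ⊢
      field_simp
      linarith
    rw [hq]
    rfl
  have : Finite (AddSubgroup.zmultiples u) :=
    Nat.finite_of_card_ne_zero (by rw [Nat.card_zmultiples, hu]; exact hn.ne')
  have hle : AddSubgroup.zmultiples w ≤ AddSubgroup.zmultiples u :=
    AddSubgroup.zmultiples_le_of_mem (key (by rw [← hw, addOrderOf_nsmul_eq_zero]))
  rw [AddSubgroup.eq_of_le_of_card_ge hle (by simp [Nat.card_zmultiples, hu, hw])]
  exact key hz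

/-- If `e • v` has order `m` and `e` has no nontrivial divisor coprime to `m`, then an element
`v` has order `m * e`. -/
theorem addOrderOf_eq_mul_of_nsmul {A : Type*} [AddCommGroup A] {m e : ℕ}
    (he0 : 0 < e) (he : ∀ h, h ∣ e → h.Coprime m → h = 1) {v : A}
    (hv : addOrderOf (e • v) = m) : addOrderOf v = m * e := by
  have h1 := addOrderOf_nsmul' v he0.ne'
  rw [hv] at h1
  set M := addOrderOf v with hM
  have hg : 0 < M.gcd e := Nat.gcd_pos_of_pos_right _ he0
  have hMg : M = m * M.gcd e := by rw [h1, Nat.div_mul_cancel (Nat.gcd_dvd_left _ _)]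
  have hcop : (e / M.gcd e).Coprime m := by
    rw [h1]; exact (Nat.coprime_div_gcd_div_gcd hg).symm
  have := he _ (Nat.div_dvd_of_dvd (Nat.gcd_dvd_right _ _)) hcop
  rwa [Nat.eq_of_dvd_of_div_eq_one (Nat.gcd_dvd_right M e) this] at hMg

/-- let `G` be a finite abelian group, `d, m` positive integers, and
`d'` the largest divisor of `d` coprime to `m`. If `ℤ/m` is a direct summand of
`d·G`, then `ℤ/(m·d/d')` is a direct summand of `G`; in particular, if `d ∣ m`
then `ℤ/(m·d)` is a direct summand of `G`. -/
theorem stmt9 (G : Type*) [AddCommGroup G] [Finite G] (d m : ℕ) (hd : 0 < d) (hm : 0 < m)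
    (d' : ℕ) (hd'1 : d' ∣ d) (hd'2 : Nat.Coprime d' m)
    (hd'3 : ∀ e : ℕ, e ∣ d → Nat.Coprime e m → e ≤ d')
    (h : ∃ K : AddSubgroup (zsmulAddGroupHom (d : ℤ) : G →+ G).range,
      Nonempty ((zsmulAddGroupHom (d : ℤ) : G →+ G).range ≃+ ZMod m × K)) :
    (∃ K : AddSubgroup G, Nonempty (G ≃+ ZMod (m * d / d') × K)) ∧
    (d ∣ m → ∃ K : AddSubgroup G, Nonempty (G ≃+ ZMod (m * d) × K)) := by
  have hsummand : ∃ K : AddSubgroup G, Nonempty (G ≃+ ZMod (m * d / d') × K) := by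
    obtain ⟨K, ⟨ε⟩⟩ := h
    obtain ⟨e, rfl⟩ := hd'1
    have hd'0 : 0 < d' := Nat.pos_of_mul_pos_right hd
    have he0 : 0 < e := Nat.pos_of_mul_pos_left hd
    have he (h : ℕ) (hh : h ∣ e) (hc : h.Coprime m) : h = 1 := by
      have h0 : 0 < h := Nat.pos_of_dvd_of_pos hh he0
      have := hd'3 (d' * h) (mul_dvd_mul_left _ hh) (hd'2.mul_left hc)
      nlinarith
    have hd'e : d'.Coprime (m * e) :=
      hd'2.mul_right (he _ (Nat.gcd_dvd_right _ _)
        (Nat.Coprime.coprime_dvd_left (Nat.gcd_dvd_left _ _) hd'2))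
    have hn : m * (d' * e) / d' = m * e := by
      rw [mul_left_comm, Nat.mul_div_cancel_left _ hd'0]
    rw [hn]
    let u : AddCircle (1 : ℚ) := ((1 / m : ℚ) : AddCircle (1 : ℚ))
    have hu : addOrderOf u = m := AddCircle.addOrderOf_period_div hm
    have hmu : m • u = 0 := hu ▸ addOrderOf_nsmul_eq_zero u
    let j : ZMod m →+ AddCircle (1 : ℚ) :=
      ZMod.lift m ⟨zmultiplesHom _ u, by simpa using hmu⟩
    have hj : j 1 = u := by
      simpa [j] using ZMod.lift_coe m ⟨zmultiplesHom _ u, by simpa using hmu⟩ 1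
    let f := (j.comp (AddMonoidHom.fst (ZMod m) K)).comp ε.toAddMonoidHom
    obtain ⟨F, hF⟩ := CharacterModule.dual_surjective_of_injective
      (zsmulAddGroupHom ((d' * e : ℕ) : ℤ) : G →+ G).range.subtype.toIntLinearMap
      Subtype.val_injective f
    replace hF (x : (zsmulAddGroupHom ((d' * e : ℕ) : ℤ) : G →+ G).range) :
      F (x : G) = j (ε x).1 := DFunLike.congr_fun hF x
    obtain ⟨y, hy⟩ := (ε.symm (1, 0)).2
    replace hy : (d' * e) • y = (ε.symm (1, 0) : G) := by
      rw [← hy, zsmulAddGroupHom_apply, natCast_zsmul]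
    have hFy : (d' * e) • F y = u := by
      rw [← map_nsmul, hy, hF, ε.apply_symm_apply, hj]
    have hmy : m • (d' * e) • y = 0 := by
      rw [hy, ← AddSubgroup.coe_nsmul, ← map_nsmul]
      simp
    have hmF (g : G) : m • (d' * e) • F g = 0 := by
      have : (d' * e) • F g = j (ε ⟨(d' * e) • g, g, natCast_zsmul g (d' * e)⟩).1 := by
        rw [← hF, map_nsmul]
      rw [this, ← map_nsmul]
      simp
    have horder : addOrderOf (d' • F y) = m * e :=
      addOrderOf_eq_mul_of_nsmul he0 he (by rw [smul_smul, mul_comm, hFy, hu])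
    have horder' : addOrderOf ((d' • F) (d' • y)) = m * e := by
      change addOrderOf (d' • F (d' • y)) = m * e
      rw [map_nsmul, Nat.Coprime.addOrderOf_nsmul (by rw [horder]; exact hd'e.symm), horder]
    refine ⟨_, nonempty_addEquiv_zmod_prod_ker (d' • F) (y := d' • y) ?_ horder' fun g => ?_⟩
    · rw [smul_smul, mul_assoc, mul_comm e, ← smul_smul, hmy]
    · refine AddCircle.mem_zmultiples_of_nsmul_eq_zero (by positivity) horder' ?_
      change (m * e) • d' • F g = 0
      rw [smul_smul, mul_assoc, mul_comm e, ← smul_smul, hmF]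
  refine ⟨hsummand, fun hdm => ?_⟩
  have : d' = 1 := Nat.Coprime.eq_one_of_dvd hd'2 (hd'1.trans hdm)
  subst this
  rwa [Nat.div_one] at hsummand
end
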